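/- arXiv:1907.00421 — 4 statements merged into one kernel-verified Lean document; each statement's English description precedes it below -/
import Mathlib

section
/- Let M₁ = (P,p₀,δ₁) and M₂ = (Q,q₀,δ₂) be two communicating machines. Then all branches in the simulation tree simtree(M₁,M₂) are successful if and only if M₁ is an asynchronous subtype of M₂ (M₁ ≤ M₂). -/
namespace AsyncSession

/-- Actions: send `!a` or receive `?a` over an alphabet `A`. -/
inductive Act (A : Type) : Type
  | send : A → Act A
  | recv : A → Act A

/-- Direction of an action: `true` for send, `false` for receive. -/
def Act.dir {A : Type} : Act A → Bool
  | .send _ => true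
  | .recv _ => false

/-- A (deterministic, directed) communicating machine with states `S`
    over alphabet `A`. -/
structure Machine (A S : Type) where
  init : S
  trans : S → Act A → S → Prop
  directed : ∀ q ℓ q' ℓ' q'', trans q ℓ q' → trans q ℓ' q'' → Act.dir ℓ = Act.dir ℓ'
  deterministic : ∀ q ℓ q' q'', trans q ℓ q' → trans q ℓ q'' → q' = q''

variable {A P Q S V W' : Type}

/-- A state is final iff it has no outgoing transitions. -/
def Machine.Final (M : Machine A S) (q : S) : Prop := ∀ ℓ q', ¬ M.trans q ℓ q'

/-- A state is sending iff it is not final and all its transitions are sends. -/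
def Machine.Sending (M : Machine A S) (q : S) : Prop :=
  ¬ M.Final q ∧ ∀ ℓ q', M.trans q ℓ q' → Act.dir ℓ = true

/-- A state is receiving iff it is not final and all its transitions are receives. -/
def Machine.Receiving (M : Machine A S) (q : S) : Prop :=
  ¬ M.Final q ∧ ∀ ℓ q', M.trans q ℓ q' → Act.dir ℓ = false

/-- `in(q)`: messages receivable at `q`. -/
def Machine.inSet (M : Machine A S) (q : S) : Set A := {a | ∃ q', M.trans q (.recv a) q'}

/-- `out(q)`: messages sendable at `q`. -/
def Machine.outSet (M : Machine A S) (q : S) : Set A := {a | ∃ q', M.trans q (.send a) q'}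

/-- Multi-step transition along a list of actions. -/
inductive ActPath (M : Machine A S) : S → List (Act A) → S → Prop
  | nil (q : S) : ActPath M q [] q
  | cons {q : S} {ℓ : Act A} {q₁ : S} {ψ : List (Act A)} {q' : S} :
      M.trans q ℓ q₁ → ActPath M q₁ ψ q' → ActPath M q (ℓ :: ψ) q'

/-- `cycle(!,q)`: a cycle of send actions is reachable from `q` via sends. -/
def SendCycle (M : Machine A S) (q : S) : Prop :=
  ∃ (ω ω' : List A) (q' : S),
    ActPath M q (ω.map Act.send) q' ∧ ω' ≠ [] ∧ ActPath M q' (ω'.map Act.send) q'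

/-- Input trees over alphabet `A` and states `S`: either a single state (a hole
filled with a state), or a nonempty finite input branching `⟨a_i : T_i⟩`. -/
inductive ITree (A S : Type) : Type
  | leaf : S → ITree A S
  | node : (dom : Finset A) → dom.Nonempty → ((a : A) → a ∈ dom → ITree A S) → ITree A S

/-- The set of states occurring at the leaves of an input tree (equivalently, the
states in the holes of the corresponding input context). -/
def ITree.leaves : ITree A S → Set S
  | .leaf q => {q}
  | .node dom _ f => {s | ∃ (a : A) (h : a ∈ dom), s ∈ (f a h).leaves}

/-- `minHeight`: the length of a shortest root-to-leaf (root-to-hole) path. -/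
noncomputable def ITree.minHeight : ITree A S → ℕ
  | .leaf _ => 0
  | .node dom _ f => 1 + sInf {h | ∃ (a : A) (ha : a ∈ dom), (f a ha).minHeight = h}
termination_by structural t => t

open Classical in
/-- `extract(𝒜,ω)`: follow the word `ω` of input messages down the tree. -/
noncomputable def ITree.extract : ITree A S → List A → Option (ITree A S)
  | t, [] => some t
  | .leaf _, _ :: _ => none
  | .node dom _ f, a :: ω => if h : a ∈ dom then (f a h).extract ω else none
termination_by structural t => t

/-- Replace every leaf `q` of a tree by some tree `t` with `R q t`
(filling of an input context, relationally). -/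
inductive ReplaceLeaves (R : S → ITree A S → Prop) : ITree A S → ITree A S → Prop
  | leaf {q : S} {t : ITree A S} : R q t → ReplaceLeaves R (.leaf q) t
  | node {dom : Finset A} {hne : dom.Nonempty} {f g : (a : A) → a ∈ dom → ITree A S} :
      (∀ a (h : a ∈ dom), ReplaceLeaves R (f a h) (g a h)) →
      ReplaceLeaves R (.node dom hne f) (.node dom hne g)

/-- `InTree M q T` holds iff `inTree(q)` is defined and equals `T`. -/
inductive InTree (M : Machine A S) : S → ITree A S → Prop
  | leaf {q : S} : M.inSet q = ∅ → InTree M q (.leaf q)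
  | node {q : S} {dom : Finset A} {hne : dom.Nonempty}
      {f : (a : A) → a ∈ dom → ITree A S} :
      (↑dom : Set A) = M.inSet q →
      (∀ a (h : a ∈ dom), ∀ q', M.trans q (.recv a) q' → InTree M q' (f a h)) →
      InTree M q (.node dom hne f)

/-- `AccTree M ω q t` holds iff `accTree(q,ω)` is defined and equals `t`. -/
def AccTree (M : Machine A S) : List A → S → ITree A S → Prop
  | [], q, t => t = .leaf q
  | a :: ω, q, t =>
      ∃ T, InTree M q T ∧
        ReplaceLeaves (fun p t' => ∃ p', M.trans p (.send a) p' ∧ AccTree M ω p' t') T t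

/-- `rcv(ψ)`: the messages of the receive actions in `ψ`, in order. -/
def rcvWord (ψ : List (Act A)) : List A :=
  ψ.filterMap fun ℓ => match ℓ with | .recv a => some a | .send _ => none

/-- `snd(ψ)`: the messages of the send actions in `ψ`, in order. -/
def sndWord (ψ : List (Act A)) : List A :=
  ψ.filterMap fun ℓ => match ℓ with | .send a => some a | .recv _ => none

/-- `MinAcc M ψ k Qs r` holds iff `minAcc(k,Qs,ψ)` is defined and equals `r`. -/
def MinAcc (M : Machine A S) : List (Act A) → ℕ → Set S → ℕ → Prop
  | [], k, _, r => r = k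
  | .recv _ :: ψ, k, Qs, r => 0 < k ∧ MinAcc M ψ (k - 1) Qs r
  | .send a :: ψ, k, Qs, r =>
      Qs.Nonempty ∧
      ∃ T : S → ITree A S,
        (∀ q ∈ Qs, AccTree M [a] q (T q)) ∧
        MinAcc M ψ (k + sInf {h | ∃ q ∈ Qs, (T q).minHeight = h})
          {q' | ∃ q ∈ Qs, q' ∈ (T q).leaves} r

/-- One step of the asynchronous subtyping simulation game, on configurations
`(p,T)` with `p` a state of `M₁` and `T` an input tree over the states of `M₂`.
The four rules are (In), (Out), (InCtx) and (OutAcc). -/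
inductive Step (M1 : Machine A P) (M2 : Machine A Q) :
    P × ITree A Q → Act A → P × ITree A Q → Prop
  | inp {p : P} {q : Q} {a : A} {p' : P} {q' : Q} :
      M1.trans p (.recv a) p' → M2.trans q (.recv a) q' →
      M2.inSet q ⊆ M1.inSet p →
      Step M1 M2 (p, .leaf q) (.recv a) (p', .leaf q')
  | out {p : P} {q : Q} {a : A} {p' : P} {q' : Q} :
      M1.trans p (.send a) p' → M2.trans q (.send a) q' →
      M1.outSet p ⊆ M2.outSet q →
      Step M1 M2 (p, .leaf q) (.send a) (p', .leaf q')
  | inCtx {p : P} {a : A} {p' : P} {dom : Finset A} {hne : dom.Nonempty}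
      {f : (b : A) → b ∈ dom → ITree A Q} (h : a ∈ dom) :
      M1.trans p (.recv a) p' → (↑dom : Set A) ⊆ M1.inSet p →
      Step M1 M2 (p, .node dom hne f) (.recv a) (p', f a h)
  | outAcc {p : P} {a : A} {p' : P} {T T' : ITree A Q} :
      M1.trans p (.send a) p' → ¬ SendCycle M1 p →
      ReplaceLeaves (fun q t => ∃ U, InTree M2 q U ∧
          ReplaceLeaves (fun qh t' => M1.outSet p ⊆ M2.outSet qh ∧
              ∃ q', M2.trans qh (.send a) q' ∧ t' = .leaf q') U t) T T' →
      Step M1 M2 (p, T) (.send a) (p', T')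

/-- The root configuration of the simulation tree. -/
def initConfig (M1 : Machine A P) (M2 : Machine A Q) : P × ITree A Q :=
  (M1.init, .leaf M2.init)

def StepAny (M1 : Machine A P) (M2 : Machine A Q) (c c' : P × ITree A Q) : Prop :=
  ∃ ℓ, Step M1 M2 c ℓ c'

/-- Configurations reachable from the root, i.e. the labels of the nodes of
the simulation tree `simtree(M₁,M₂)`. -/
def CReach (M1 : Machine A P) (M2 : Machine A Q) (c : P × ITree A Q) : Prop :=
  Relation.ReflTransGen (StepAny M1 M2) (initConfig M1 M2) c

/-- A successful leaf: a pair of final states with empty input context. -/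
def SuccessfulConfig (M1 : Machine A P) (M2 : Machine A Q) (c : P × ITree A Q) : Prop :=
  ∃ p q, c = (p, ITree.leaf q) ∧ M1.Final p ∧ M2.Final q

/-- All branches of `simtree(M₁,M₂)` are successful: every branch is infinite or
ends in a successful leaf, i.e. every reachable node without successors is a
successful leaf. -/
def AllBranchesSuccessful (M1 : Machine A P) (M2 : Machine A Q) : Prop :=
  ∀ c, CReach M1 M2 c → (∀ ℓ c', ¬ Step M1 M2 c ℓ c') → SuccessfulConfig M1 M2 c

/-- Asynchronous subtyping relations (Definition of asynchronous subtyping). -/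
def IsSubtypingRel (M1 : Machine A P) (M2 : Machine A Q)
    (R : P → ITree A Q → Prop) : Prop :=
  ∀ p T, R p T →
    (M1.Final p → ∃ q, T = ITree.leaf q ∧ M2.Final q) ∧
    (M1.Receiving p →
      (∀ q, T = ITree.leaf q →
        M2.Receiving q ∧
        ∀ a q', M2.trans q (.recv a) q' →
          ∃ p', M1.trans p (.recv a) p' ∧ R p' (ITree.leaf q')) ∧
      (∀ (dom : Finset A) (hne : dom.Nonempty) (f : (a : A) → a ∈ dom → ITree A Q),
        T = ITree.node dom hne f →
        ∀ a (h : a ∈ dom), ∃ p', M1.trans p (.recv a) p' ∧ R p' (f a h))) ∧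
    (M1.Sending p →
      (∀ q, T = ITree.leaf q → M2.Sending q →
        ∀ a p', M1.trans p (.send a) p' →
          ∃ q', M2.trans q (.send a) q' ∧ R p' (ITree.leaf q')) ∧
      ((¬ ∃ q, T = ITree.leaf q ∧ M2.Sending q) →
        ¬ SendCycle M1 p ∧
        (∀ q ∈ T.leaves, ∃ U, InTree M2 q U) ∧
        (∀ a p', M1.trans p (.send a) p' →
          ∃ T', ReplaceLeaves (fun q t => ∃ U, InTree M2 q U ∧
              ReplaceLeaves (fun qh t' => ∃ q', M2.trans qh (.send a) q' ∧
                  t' = ITree.leaf q') U t) T T' ∧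
            R p' T')))

/-- `M₁ ≤ M₂`: asynchronous session subtyping. -/
def Subtyping (M1 : Machine A P) (M2 : Machine A Q) : Prop :=
  ∃ R, IsSubtypingRel M1 M2 R ∧ R M1.init (ITree.leaf M2.init)

/-! ### Nodes of the simulation tree and (candidate/witness) subtrees -/

/-- A node of the simulation tree: the sequence of edge labels from the root
together with the configuration labelling the node. -/
abbrev SNode (A P Q : Type) := List (Act A) × (P × ITree A Q)

/-- The root node of the simulation tree. -/
def rootNode (M1 : Machine A P) (M2 : Machine A Q) : SNode A P Q :=
  ([], initConfig M1 M2)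

/-- Labelled edges of the simulation tree. -/
def Edge (M1 : Machine A P) (M2 : Machine A Q)
    (n : SNode A P Q) (ℓ : Act A) (n' : SNode A P Q) : Prop :=
  n'.1 = n.1 ++ [ℓ] ∧ Step M1 M2 n.2 ℓ n'.2

def EdgeAny (M1 : Machine A P) (M2 : Machine A Q) (n n' : SNode A P Q) : Prop :=
  ∃ ℓ, Edge M1 M2 n ℓ n'

/-- `n ↝* n'`. -/
def NReach (M1 : Machine A P) (M2 : Machine A Q) : SNode A P Q → SNode A P Q → Prop :=
  Relation.ReflTransGen (EdgeAny M1 M2)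

/-- `n ↝⁺ n'`. -/
def NReachPlus (M1 : Machine A P) (M2 : Machine A Q) : SNode A P Q → SNode A P Q → Prop :=
  Relation.TransGen (EdgeAny M1 M2)

/-- `n ↝^ψ n'`: path with label sequence `ψ`. -/
inductive EdgePath (M1 : Machine A P) (M2 : Machine A Q) :
    SNode A P Q → List (Act A) → SNode A P Q → Prop
  | nil (n : SNode A P Q) : EdgePath M1 M2 n [] n
  | cons {n : SNode A P Q} {ℓ : Act A} {n₁ : SNode A P Q} {ψ : List (Act A)}
      {n' : SNode A P Q} :
      Edge M1 M2 n ℓ n₁ → EdgePath M1 M2 n₁ ψ n' → EdgePath M1 M2 n (ℓ :: ψ) n'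

/-- Data of a subtree of the simulation tree: a root `r`, a boundary `B`, and an
ancestor function `anc` (only its values on `B` matter). -/
structure SubtreeData (A P Q : Type) where
  r : SNode A P Q
  B : Set (SNode A P Q)
  anc : SNode A P Q → SNode A P Q

/-- `nodes(r,B)`: the nodes of the finite subtree. -/
def SubtreeData.nodes (W : SubtreeData A P Q) (M1 : Machine A P) (M2 : Machine A Q) :
    Set (SNode A P Q) :=
  {n | NReach M1 M2 W.r n ∧ ∃ b ∈ W.B, NReach M1 M2 n b}

/-- `(r,B)` is a finite subtree of `simtree(M₁,M₂)`. -/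
def SubtreeData.IsFiniteSubtree (W : SubtreeData A P Q)
    (M1 : Machine A P) (M2 : Machine A Q) : Prop :=
  NReach M1 M2 (rootNode M1 M2) W.r ∧
  W.B.Finite ∧
  (∀ n ∈ W.B, NReach M1 M2 W.r n) ∧
  (∀ n ∈ W.B, ∀ n' ∈ W.B, ¬ NReachPlus M1 M2 n n') ∧
  (∀ n, NReach M1 M2 W.r n → ∃ n' ∈ W.B, NReach M1 M2 n n' ∨ NReach M1 M2 n' n)

/-- `(r,B,anc)` is a candidate subtree of `simtree(M₁,M₂)`. -/
def SubtreeData.IsCandidate (W : SubtreeData A P Q)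
    (M1 : Machine A P) (M2 : Machine A Q) : Prop :=
  W.IsFiniteSubtree M1 M2 ∧
  ∀ n ∈ W.B,
    W.anc n ∈ W.nodes M1 M2 \ W.B ∧
    NReachPlus M1 M2 (W.anc n) n ∧
    n.2.1 = (W.anc n).2.1 ∧
    (n.2.2).leaves ⊆ ((W.anc n).2.2).leaves

/-- `tr(n)`: `n` itself if it is not a boundary node, its ancestor otherwise. -/
noncomputable def SubtreeData.tr (W : SubtreeData A P Q) (n : SNode A P Q) : SNode A P Q := by
  classical exact if n ∈ W.B then W.anc n else n

/-! ### Input tree expressions, systems of input tree equations, compatibility -/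

/-- Input tree expressions over alphabet `A` and variables `V`:
variables, input choices, and silent choices. -/
inductive ITExpr (A V : Type) : Type
  | var : V → ITExpr A V
  | inp : (dom : Finset A) → dom.Nonempty → ((a : A) → a ∈ dom → ITExpr A V) → ITExpr A V
  | sil : ITExpr A V → List (ITExpr A V) → ITExpr A V

/-- Turn an input tree into an input tree expression by replacing each leaf
state `q` by the variable `v q`. -/
def ITree.toExprVar : ITree A S → (S → V) → ITExpr A V
  | .leaf q, v => .var (v q)
  | .node dom hne f, v => .inp dom hne fun a h => (f a h).toExprVar v

/-- Relational version: replace each leaf `q` by some expression `e` with `R q e`. -/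
inductive ToExpr (R : S → ITExpr A V → Prop) : ITree A S → ITExpr A V → Prop
  | leaf {q : S} {e : ITExpr A V} : R q e → ToExpr R (.leaf q) e
  | node {dom : Finset A} {hne : dom.Nonempty} {f : (a : A) → a ∈ dom → ITree A S}
      {g : (a : A) → a ∈ dom → ITExpr A V} :
      (∀ a (h : a ∈ dom), ToExpr R (f a h) (g a h)) →
      ToExpr R (.node dom hne f) (.inp dom hne g)

/-- Compatibility relations between two systems of input tree equations, given by
their definition maps `defL` and `defR`. -/
def IsCompatRel (defL : V → ITExpr A V) (defR : W' → ITExpr A W')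
    (R : ITExpr A V → ITExpr A W' → Prop) : Prop :=
  (∀ (X : V) (E : ITExpr A W'), R (.var X) E → R (defL X) E) ∧
  (∀ (E : ITExpr A V) (X : W'), R E (.var X) → R E (defR X)) ∧
  (∀ (e₀ : ITExpr A V) (es : List (ITExpr A V)) (E : ITExpr A W'),
      R (.sil e₀ es) E → ∀ e ∈ e₀ :: es, R e E) ∧
  (∀ (E : ITExpr A V) (e₀ : ITExpr A W') (es : List (ITExpr A W')),
      R E (.sil e₀ es) → ∀ e ∈ e₀ :: es, R E e) ∧
  (∀ (dom : Finset A) (hne : dom.Nonempty) (f : (a : A) → a ∈ dom → ITExpr A V)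
      (dom' : Finset A) (hne' : dom'.Nonempty) (g : (a : A) → a ∈ dom' → ITExpr A W'),
      R (.inp dom hne f) (.inp dom' hne' g) →
      dom ⊆ dom' ∧ ∀ a (h : a ∈ dom) (h' : a ∈ dom'), R (f a h) (g a h'))

/-- `E ⊑ E'`: compatibility of two expressions w.r.t. the definition maps. -/
def Compat (defL : V → ITExpr A V) (defR : W' → ITExpr A W')
    (E : ITExpr A V) (E' : ITExpr A W') : Prop :=
  ∃ R, IsCompatRel defL defR R ∧ R E E'

/-- Specification of the system `𝒢` of condition (3a) of the witness-subtree
definition: variables are `X₀` (`none`) and `X_{q,n}` (`some (q,n)`). -/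
def GSpec (M1 : Machine A P) (M2 : Machine A Q) (W : SubtreeData A P Q)
    (EG : Option (Q × SNode A P Q) → ITExpr A (Option (Q × SNode A P Q))) : Prop :=
  ToExpr (fun q e => e = .var (some (q, W.r))) (W.r.2.2) (EG none) ∧
  ∀ (q : Q), ∀ n ∈ W.nodes M1 M2 \ W.B,
    ((∃ a n', Edge M1 M2 n (.recv a) n') →
       ∃ e₀ es, EG (some (q, n)) = .sil e₀ es ∧
         ∀ e, e ∈ e₀ :: es ↔ ∃ a n', Edge M1 M2 n (.recv a) n' ∧
           e = .var (some (q, W.tr n'))) ∧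
    ((¬ ∃ a n', Edge M1 M2 n (.recv a) n') → (∃ a n', Edge M1 M2 n (.send a) n') →
       ∃ e₀ es, EG (some (q, n)) = .sil e₀ es ∧
         ∀ e, e ∈ e₀ :: es ↔ ∃ a n', Edge M1 M2 n (.send a) n' ∧
           ∃ U, InTree M2 q U ∧
             ToExpr (fun qi e' => ∃ q', M2.trans qi (.send a) q' ∧
               e' = .var (some (q', W.tr n'))) U e)

/-- Specification of the system `𝒢'` of condition (3b) of the witness-subtree
definition: variables are `Y_n`. -/
def G'Spec (M1 : Machine A P) (M2 : Machine A Q) (W : SubtreeData A P Q)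
    (EG' : SNode A P Q → ITExpr A (SNode A P Q)) : Prop :=
  ∀ n ∈ W.nodes M1 M2 \ W.B,
    ((∃ a n', Edge M1 M2 n (.send a) n') →
       ∃ e₀ es, EG' n = .sil e₀ es ∧
         ∀ e, e ∈ e₀ :: es ↔ ∃ a n', Edge M1 M2 n (.send a) n' ∧ e = .var (W.tr n')) ∧
    ((∃ a n', Edge M1 M2 n (.recv a) n') →
       ∃ (dom : Finset A) (hne : dom.Nonempty) (g : (a : A) → a ∈ dom → ITExpr A (SNode A P Q)),
         EG' n = .inp dom hne g ∧
         (↑dom : Set A) = {a | ∃ n', Edge M1 M2 n (.recv a) n'} ∧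
         ∀ a (h : a ∈ dom), ∀ n', Edge M1 M2 n (.recv a) n' → g a h = .var (W.tr n'))

/-- `(r,B,anc)` is a witness subtree of `simtree(M₁,M₂)`. -/
def SubtreeData.IsWitness (W : SubtreeData A P Q)
    (M1 : Machine A P) (M2 : Machine A Q) : Prop :=
  W.IsCandidate M1 M2 ∧
  -- (1) at least one receive action between an ancestor and its boundary node
  (∀ n ∈ W.B, ∀ ψ, EdgePath M1 M2 (W.anc n) ψ n → 0 < (rcvWord ψ).length) ∧
  -- (2) conditions (2a) and (2b)
  (∀ n ∈ W.anc '' W.B, ∀ n' ∈ W.anc '' W.B ∪ W.B, ∀ ψ, EdgePath M1 M2 n ψ n' →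
    (∀ q ∈ (n.2.2).leaves,
        ∃ t, AccTree M2 (sndWord ψ) q t ∧ t.leaves ⊆ (n'.2.2).leaves) ∧
    (n' ∈ W.B →
        ∃ m, MinAcc M2 ψ ((n.2.2).minHeight) ((n.2.2).leaves) m ∧
          (n.2.2).minHeight ≤ m)) ∧
  -- (3) compatibility of the two systems of input tree equations
  (∃ EG EG', GSpec M1 M2 W EG ∧ G'Spec M1 M2 W EG' ∧
      Compat EG EG' (ITExpr.var none) (ITExpr.var W.r))


theorem ReplaceLeaves.exists_of {R : S → ITree A S → Prop} (T : ITree A S)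
    (h : ∀ q ∈ T.leaves, ∃ t, R q t) : ∃ T', ReplaceLeaves R T T' := by
  induction T with
  | leaf q =>
    obtain ⟨t, ht⟩ := h q (by simp [ITree.leaves])
    exact ⟨t, .leaf ht⟩
  | node dom hne f ih =>
    have : ∀ a (ha : a ∈ dom), ∃ T', ReplaceLeaves R (f a ha) T' := fun a ha =>
      ih a ha fun q hq => h q ⟨a, ha, hq⟩
    choose g hg using this
    exact ⟨.node dom hne g, .node hg⟩

theorem ReplaceLeaves.leaves {R : S → ITree A S → Prop} {T T' : ITree A S}
    (h : ReplaceLeaves R T T') : ∀ q ∈ T.leaves, ∃ t, R q t := by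
  induction h with
  | leaf h =>
    intro q hq
    have : q = _ := hq
    subst this
    exact ⟨_, h⟩
  | node _ ih =>
    rintro q ⟨a, ha, hq⟩
    exact ih a ha q hq

theorem ReplaceLeaves.mono {R R' : S → ITree A S → Prop} (hR : ∀ q t, R q t → R' q t)
    {T T' : ITree A S} (h : ReplaceLeaves R T T') : ReplaceLeaves R' T T' := by
  induction h with
  | leaf h => exact .leaf (hR _ _ h)
  | node _ ih => exact .node ih

theorem ReplaceLeaves.functional {R : S → ITree A S → Prop}
    (hR : ∀ q t t', R q t → R q t' → t = t') {T T' : ITree A S}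
    (h : ReplaceLeaves R T T') : ∀ T'', ReplaceLeaves R T T'' → T' = T'' := by
  induction h with
  | leaf h =>
    intro T'' h''
    cases h'' with
    | leaf h2 => exact hR _ _ _ h h2
  | node _ ih =>
    intro T'' h''
    cases h'' with
    | node h2 =>
      congr 1
      funext a ha
      exact ih a ha _ (h2 a ha)

theorem InTree.functional {M : Machine A S} {q : S} {U : ITree A S}
    (h : InTree M q U) : ∀ U', InTree M q U' → U = U' := by
  induction h with
  | leaf h =>
    intro U' h'
    cases h' with
    | leaf _ => rfl
    | @node _ dom hne f hd _ =>
      exfalso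
      rw [h] at hd
      exact hne.ne_empty (by exact_mod_cast hd)
  | @node q dom hne f hd hf ih =>
    intro U' h'
    cases h' with
    | leaf h =>
      exfalso
      rw [h] at hd
      exact hne.ne_empty (by exact_mod_cast hd)
    | @node _ dom' hne' f' hd' hf' =>
      have e : dom = dom' := by
        have := hd.trans hd'.symm
        exact_mod_cast this
      subst e
      congr 1
      funext a ha
      have : a ∈ M.inSet q := by rw [← hd]; exact_mod_cast ha
      obtain ⟨q', hq'⟩ := this
      exact ih a ha q' hq' _ (hf' a ha q' hq')

theorem Machine.sending_of {M : Machine A S} {q q' : S} {a : A}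
    (h : M.trans q (.send a) q') : M.Sending q :=
  ⟨fun hf => hf _ _ h, fun _ _ h' => M.directed _ _ _ _ _ h' h⟩

theorem Machine.receiving_of {M : Machine A S} {q q' : S} {a : A}
    (h : M.trans q (.recv a) q') : M.Receiving q :=
  ⟨fun hf => hf _ _ h, fun _ _ h' => M.directed _ _ _ _ _ h' h⟩

theorem Machine.Sending.exists_trans {M : Machine A S} {q : S} (h : M.Sending q) :
    ∃ a q', M.trans q (.send a) q' := by
  by_contra hc
  push Not at hc
  refine h.1 fun ℓ q' ht => ?_
  cases ℓ with
  | send a => exact hc _ _ ht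
  | recv a => exact absurd (h.2 _ _ ht) (by simp [Act.dir])

theorem Machine.Receiving.exists_trans {M : Machine A S} {q : S} (h : M.Receiving q) :
    ∃ a q', M.trans q (.recv a) q' := by
  by_contra hc
  push Not at hc
  refine h.1 fun ℓ q' ht => ?_
  cases ℓ with
  | recv a => exact hc _ _ ht
  | send a => exact absurd (h.2 _ _ ht) (by simp [Act.dir])

theorem Machine.Sending.no_recv {M : Machine A S} {q q' : S} {a : A} (h : M.Sending q) :
    ¬ M.trans q (.recv a) q' := fun ht => absurd (h.2 _ _ ht) (by simp [Act.dir])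

theorem Machine.Receiving.no_send {M : Machine A S} {q q' : S} {a : A} (h : M.Receiving q) :
    ¬ M.trans q (.send a) q' := fun ht => absurd (h.2 _ _ ht) (by simp [Act.dir])

theorem Machine.cases (M : Machine A S) (q : S) :
    M.Final q ∨ M.Receiving q ∨ M.Sending q := by
  by_cases h : M.Final q
  · exact .inl h
  · right
    unfold Machine.Final at h
    push Not at h
    obtain ⟨ℓ, q', ht⟩ := h
    cases ℓ with
    | send a => exact .inr (M.sending_of ht)
    | recv a => exact .inl (M.receiving_of ht)

theorem InTree.sending {M : Machine A S} {q : S} (h : M.Sending q) : InTree M q (.leaf q) := by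
  apply InTree.leaf
  ext a
  simp only [Machine.inSet, Set.mem_setOf_eq, Set.mem_empty_iff_false, iff_false]
  rintro ⟨q', hq⟩
  exact h.no_recv hq

theorem outAcc_functional (M2 : Machine A Q) (a : A) {T T' T'' : ITree A Q}
    (h : ReplaceLeaves (fun q t => ∃ U, InTree M2 q U ∧
              ReplaceLeaves (fun qh t' => ∃ q', M2.trans qh (.send a) q' ∧
                  t' = ITree.leaf q') U t) T T')
    (h' : ReplaceLeaves (fun q t => ∃ U, InTree M2 q U ∧
              ReplaceLeaves (fun qh t' => ∃ q', M2.trans qh (.send a) q' ∧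
                  t' = ITree.leaf q') U t) T T'') : T' = T'' := by
  refine ReplaceLeaves.functional ?_ h _ h'
  rintro q t t' ⟨U, hU, ht⟩ ⟨U', hU', ht'⟩
  obtain rfl := hU.functional _ hU'
  refine ReplaceLeaves.functional ?_ ht _ ht'
  rintro q t t' ⟨r, hr, rfl⟩ ⟨r', hr', rfl⟩
  rw [M2.deterministic _ _ _ _ hr hr']

theorem outAcc_weaken {M2 : Machine A Q} {a : A} {O : Set A} {T T' : ITree A Q}
    (h : ReplaceLeaves (fun q t => ∃ U, InTree M2 q U ∧
          ReplaceLeaves (fun qh t' => O ⊆ M2.outSet qh ∧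
              ∃ q', M2.trans qh (.send a) q' ∧ t' = .leaf q') U t) T T') :
    ReplaceLeaves (fun q t => ∃ U, InTree M2 q U ∧
              ReplaceLeaves (fun qh t' => ∃ q', M2.trans qh (.send a) q' ∧
                  t' = ITree.leaf q') U t) T T' := by
  refine h.mono ?_
  rintro q t ⟨U, hU, ht⟩
  exact ⟨U, hU, ht.mono fun _ _ h => h.2⟩

theorem subtyping_of_branches (M1 : Machine A P) (M2 : Machine A Q)
    (H : AllBranchesSuccessful M1 M2) : Subtyping M1 M2 := by
  refine ⟨fun p T => CReach M1 M2 (p, T), ?_, .refl⟩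
  intro p T hR
  have next : ∀ {ℓ c'}, Step M1 M2 (p, T) ℓ c' → CReach M1 M2 c' :=
    fun h => Relation.ReflTransGen.tail hR ⟨_, h⟩
  have stuck : ¬ M1.Final p → ∃ ℓ c', Step M1 M2 (p, T) ℓ c' := by
    intro hp
    by_contra hc
    push Not at hc
    obtain ⟨p1, q, he, hf, _⟩ := H _ hR hc
    cases he
    exact hp hf
  refine ⟨?_, ?_, ?_⟩
  · intro hp
    have : ∀ ℓ c', ¬ Step M1 M2 (p, T) ℓ c' := by
      intro ℓ c' h
      cases h <;> exact hp _ _ (by assumption)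
    obtain ⟨p1, q, he, _, hq⟩ := H _ hR this
    cases he
    exact ⟨q, rfl, hq⟩
  · intro hp
    obtain ⟨ℓ, c', hs⟩ := stuck hp.1
    refine ⟨?_, ?_⟩
    · rintro q rfl
      cases hs with
      | out h1 => exact absurd h1 hp.no_send
      | outAcc h1 => exact absurd h1 hp.no_send
      | inp h1 h2 h3 =>
        refine ⟨M2.receiving_of h2, fun a q' hq => ?_⟩
        obtain ⟨p', hp'⟩ := h3 ⟨q', hq⟩
        exact ⟨p', hp', next (.inp hp' hq h3)⟩
    · rintro dom hne f rfl a ha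
      cases hs with
      | outAcc h1 => exact absurd h1 hp.no_send
      | inCtx h h1 h3 =>
        obtain ⟨p', hp'⟩ := h3 (by exact_mod_cast ha : a ∈ (↑dom : Set A))
        exact ⟨p', hp', next (.inCtx ha hp' h3)⟩
  · intro hp
    obtain ⟨ℓ, c', hs⟩ := stuck hp.1
    refine ⟨?_, ?_⟩
    · rintro q rfl hq
      have hsub : M1.outSet p ⊆ M2.outSet q := by
        cases hs with
        | inp h1 => exact absurd h1 hp.no_recv
        | out _ _ h => exact h
        | outAcc h1 h2 h3 =>
          cases h3 with
          | leaf h =>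
            obtain ⟨U, hU, h⟩ := h
            obtain rfl := (InTree.sending hq).functional _ hU
            cases h with
            | leaf h => exact h.1
      intro a p' hp'
      obtain ⟨q', hq'⟩ := hsub ⟨p', hp'⟩
      exact ⟨q', hq', next (.out hp' hq' hsub)⟩
    · intro hn
      cases hs with
      | inp h1 => exact absurd h1 hp.no_recv
      | inCtx _ h1 => exact absurd h1 hp.no_recv
      | out _ h => exact absurd ⟨_, rfl, M2.sending_of h⟩ hn
      | outAcc h1 h2 h3 =>
        have hl := h3.leaves
        refine ⟨h2, fun q hq => ?_, fun a p' hp' => ?_⟩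
        · obtain ⟨t, U, hU, _⟩ := hl q hq
          exact ⟨U, hU⟩
        · obtain ⟨T', hT'⟩ := ReplaceLeaves.exists_of (R := fun q t => ∃ U, InTree M2 q U ∧
            ReplaceLeaves (fun qh t' => M1.outSet p ⊆ M2.outSet qh ∧
              ∃ q', M2.trans qh (.send a) q' ∧ t' = .leaf q') U t) T (by
            intro q hq
            obtain ⟨t, U, hU, ht⟩ := hl q hq
            obtain ⟨t', ht'⟩ := ReplaceLeaves.exists_of
              (R := fun qh t' => M1.outSet p ⊆ M2.outSet qh ∧
                ∃ q', M2.trans qh (.send a) q' ∧ t' = .leaf q') U (by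
              intro r hr
              obtain ⟨_, hsub, _⟩ := ht.leaves r hr
              obtain ⟨q', hq'⟩ := hsub ⟨p', hp'⟩
              exact ⟨_, hsub, q', hq', rfl⟩)
            exact ⟨t', U, hU, ht'⟩)
          exact ⟨T', outAcc_weaken hT', next (.outAcc hp' h2 hT')⟩

theorem rel_step {M1 : Machine A P} {M2 : Machine A Q} {R : P → ITree A Q → Prop}
    (hR : IsSubtypingRel M1 M2 R) {c c' : P × ITree A Q} {ℓ : Act A}
    (hc : R c.1 c.2) (hs : Step M1 M2 c ℓ c') : R c'.1 c'.2 := by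
  cases hs with
  | inp h1 h2 h3 =>
    obtain ⟨p', hp', hr⟩ := (((hR _ _ hc).2.1 (M1.receiving_of h1)).1 _ rfl).2 _ _ h2
    rwa [M1.deterministic _ _ _ _ h1 hp']
  | out h1 h2 h3 =>
    obtain ⟨q', hq', hr⟩ :=
      ((hR _ _ hc).2.2 (M1.sending_of h1)).1 _ rfl (M2.sending_of h2) _ _ h1
    rwa [M2.deterministic _ _ _ _ h2 hq']
  | inCtx h h1 h3 =>
    obtain ⟨p', hp', hr⟩ := ((hR _ _ hc).2.1 (M1.receiving_of h1)).2 _ _ _ rfl _ h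
    rwa [M1.deterministic _ _ _ _ h1 hp']
  | @outAcc p a p' T T' h1 h2 h3 =>
    obtain ⟨hA, hB⟩ := (hR _ _ hc).2.2 (M1.sending_of h1)
    by_cases hn : ∃ q, T = ITree.leaf q ∧ M2.Sending q
    · obtain ⟨q, rfl, hq⟩ := hn
      obtain ⟨q', hq', hr⟩ := hA q rfl hq _ _ h1
      have : T' = .leaf q' := outAcc_functional M2 a (outAcc_weaken h3)
        (.leaf ⟨_, InTree.sending hq, .leaf ⟨q', hq', rfl⟩⟩)
      rwa [this]
    · obtain ⟨_, _, h⟩ := hB hn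
      obtain ⟨T'', hT, hr⟩ := h _ _ h1
      rwa [outAcc_functional M2 a (outAcc_weaken h3) hT]

theorem branches_of_subtyping (M1 : Machine A P) (M2 : Machine A Q)
    (H : Subtyping M1 M2) : AllBranchesSuccessful M1 M2 := by
  obtain ⟨R, hR, h0⟩ := H
  intro c hc hstuck
  have hrc : R c.1 c.2 := by
    clear hstuck
    induction hc with
    | refl => exact h0
    | tail _ hs ih =>
      obtain ⟨ℓ, hs⟩ := hs
      exact rel_step hR ih hs
  obtain ⟨p, T⟩ := c
  obtain ⟨hF, hI, hO⟩ := hR p T hrc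
  rcases M1.cases p with hp | hp | hp
  · obtain ⟨q, rfl, hq⟩ := hF hp
    exact ⟨p, q, rfl, hp, hq⟩
  · exfalso
    obtain ⟨h1, h2⟩ := hI hp
    cases T with
    | leaf q =>
      obtain ⟨hq, h⟩ := h1 q rfl
      obtain ⟨a, q', hq'⟩ := hq.exists_trans
      obtain ⟨p', hp', _⟩ := h _ _ hq'
      refine hstuck _ _ (.inp hp' hq' ?_)
      rintro b ⟨r, hr⟩
      obtain ⟨s, hs, _⟩ := h _ _ hr
      exact ⟨s, hs⟩
    | node dom hne f =>
      have h := h2 _ _ _ rfl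
      obtain ⟨a, ha⟩ := id hne
      obtain ⟨p', hp', _⟩ := h a ha
      refine hstuck _ _ (.inCtx ha hp' ?_)
      intro b hb
      obtain ⟨s, hs, _⟩ := h b (by exact_mod_cast hb)
      exact ⟨s, hs⟩
  · exfalso
    obtain ⟨hA, hB⟩ := hO hp
    obtain ⟨a, p', hp'⟩ := hp.exists_trans
    by_cases hn : ∃ q, T = ITree.leaf q ∧ M2.Sending q
    · obtain ⟨q, rfl, hq⟩ := hn
      obtain ⟨q', hq', _⟩ := hA q rfl hq _ _ hp'
      refine hstuck _ _ (.out hp' hq' ?_)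
      rintro b ⟨r, hr⟩
      obtain ⟨s, hs, _⟩ := hA q rfl hq _ _ hr
      exact ⟨s, hs⟩
    · obtain ⟨hcyc, hin, h⟩ := hB hn
      have key : ∀ q ∈ T.leaves, ∀ U, InTree M2 q U → ∀ r ∈ U.leaves,
          M1.outSet p ⊆ M2.outSet r := by
        rintro q hq U hU r hr b ⟨s, hs⟩
        obtain ⟨T', hT', _⟩ := h _ _ hs
        obtain ⟨t, U', hU', ht⟩ := hT'.leaves q hq
        obtain rfl := hU.functional _ hU'
        obtain ⟨_, q', hq', _⟩ := ht.leaves r hr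
        exact ⟨q', hq'⟩
      obtain ⟨T', hT'⟩ := ReplaceLeaves.exists_of (R := fun q t => ∃ U, InTree M2 q U ∧
            ReplaceLeaves (fun qh t' => M1.outSet p ⊆ M2.outSet qh ∧
              ∃ q', M2.trans qh (.send a) q' ∧ t' = .leaf q') U t) T (by
            intro q hq
            obtain ⟨U, hU⟩ := hin q hq
            obtain ⟨t', ht'⟩ := ReplaceLeaves.exists_of
              (R := fun qh t' => M1.outSet p ⊆ M2.outSet qh ∧
                ∃ q', M2.trans qh (.send a) q' ∧ t' = .leaf q') U (by
              intro r hr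
              have hsub := key q hq U hU r hr
              obtain ⟨q', hq'⟩ := hsub ⟨p', hp'⟩
              exact ⟨_, hsub, q', hq', rfl⟩)
            exact ⟨t', U, hU, ht'⟩)
      exact hstuck _ _ (.outAcc hp' hcyc hT')

/-- All branches in the simulation tree `simtree(M₁,M₂)` are
successful if and only if `M₁ ≤ M₂`. -/
theorem allBranchesSuccessful_iff_subtyping
    {A P Q : Type} [Fintype A] [Fintype P] [Fintype Q]
    (M1 : Machine A P) (M2 : Machine A Q) :
    AllBranchesSuccessful M1 M2 ↔ Subtyping M1 M2 := by
  exact ⟨subtyping_of_branches M1 M2, branches_of_subtyping M1 M2⟩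

end AsyncSession
end

section
/- Let M₁ = (P,p₀,δ₁) and M₂ = (Q,q₀,δ₂) be two communicating machines. For each infinite path n₀ ↝ n₁ ↝ n₂ ↝ ⋯ in the simulation tree simtree(M₁,M₂) there exist indices i < j < k and labels ℒ(n_i) = (p, 𝒜_i[q_h]^{h∈H_i}), ℒ(n_j) = (p, 𝒜_j[q'_h]^{h∈H_j}), ℒ(n_k) = (p, 𝒜_k[q''_h]^{h∈H_k}) (with the same machine-M₁ state p in all three) such that {q'_h | h∈H_j} ⊆ {q_h | h∈H_i} and {q''_h | h∈H_k} ⊆ {q_h | h∈H_i}, and, letting ψ be the sequence of edge labels on the path n_i ↝^ψ n_j, either (i) rcv(ψ) = ω₁·ω₂ for some ω₁ such that both extract(𝒜_i,ω₁) and extract(𝒜_k,ω₁) are single holes, or (ii) minHeight(extract(𝒜_i, rcv(ψ))) ≤ minHeight(extract(𝒜_k, rcv(ψ))). -/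
namespace AsyncSession

variable {A P Q S V W' : Type}

/-! ### Proof -/

theorem Act.finite_act {A : Type} [Finite A] : Finite (Act A) := by
  refine Finite.of_injective (β := A ⊕ A)
    (fun x => match x with | .send a => Sum.inl a | .recv a => Sum.inr a) ?_
  rintro (a | a) (b | b) h <;> simp_all

/-- `t` is obtained from a truncation by replacing leaves. -/
abbrev Grows {A S : Type} : ITree A S → ITree A S → Prop :=
  ReplaceLeaves (fun _ _ => True)

theorem Grows.rfl {A S : Type} (t : ITree A S) : Grows t t := by
  induction t with
  | leaf q => exact ReplaceLeaves.leaf trivial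
  | node dom hne f ih => exact ReplaceLeaves.node ih

theorem Grows.trans {A S : Type} {R : S → ITree A S → Prop} {t u v : ITree A S}
    (h : Grows t u) (h' : ReplaceLeaves R u v) : Grows t v := by
  induction h generalizing v with
  | leaf _ => exact ReplaceLeaves.leaf trivial
  | node _ ih =>
    cases h' with
    | node h'' => exact ReplaceLeaves.node fun a ha => ih a ha (h'' a ha)

theorem extract_append {A S : Type} (t u : ITree A S) (ω ω' : List A)
    (h : t.extract ω = some u) : t.extract (ω ++ ω') = u.extract ω' := by
  induction ω generalizing t with
  | nil =>
    cases t <;> (simp [ITree.extract] at h; subst h; rfl)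
  | cons a ω ih =>
    cases t with
    | leaf q => simp [ITree.extract] at h
    | node dom hne f =>
      simp only [ITree.extract, List.cons_append] at h ⊢
      split_ifs at h ⊢ with hm
      exact ih _ h

theorem extract_nil {A S : Type} (t : ITree A S) : t.extract [] = some t := by
  cases t <;> rfl

theorem path_lemma {A P Q : Type} (M1 : Machine A P) (M2 : Machine A Q)
    (c : ℕ → P × ITree A Q) (ℓ : ℕ → Act A)
    (hstep : ∀ i, Step M1 M2 (c i) (ℓ i) (c (i + 1))) (i d : ℕ) :
    (∃ ω₁, ω₁ <+: rcvWord ((List.range d).map (fun m => ℓ (i + m))) ∧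
      ∃ q, ((c i).2).extract ω₁ = some (ITree.leaf q)) ∨
    ∃ t, ((c i).2).extract (rcvWord ((List.range d).map (fun m => ℓ (i + m)))) = some t ∧
      Grows t (c (i + d)).2 := by
  induction d with
  | zero =>
    right
    exact ⟨(c i).2, extract_nil _, Grows.rfl _⟩
  | succ d ih =>
    have hw : rcvWord ((List.range (d+1)).map (fun m => ℓ (i + m))) =
        rcvWord ((List.range d).map (fun m => ℓ (i + m))) ++ rcvWord [ℓ (i + d)] := by
      simp [rcvWord, List.range_succ, List.filterMap_append]
    rw [hw]
    generalize rcvWord ((List.range d).map (fun m => ℓ (i + m))) = ω at ih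
    rcases ih with ⟨ω₁, hp, hq⟩ | ⟨t, ht, hg⟩
    · exact Or.inl ⟨ω₁, hp.trans (List.prefix_append _ _), hq⟩
    · by_cases hl : ∃ q, t = .leaf q
      · obtain ⟨q, rfl⟩ := hl
        exact Or.inl ⟨ω, List.prefix_append _ _, q, ht⟩
      right
      have hs := hstep (i + d)
      rw [show i + (d + 1) = i + d + 1 from by omega]
      rw [extract_append _ _ _ _ ht]
      generalize c (i + d) = x at *
      generalize c (i + d + 1) = y at *
      generalize ℓ (i + d) = l at *
      cases hs with
      | inp _ _ _ => cases hg; exact (hl ⟨_, rfl⟩).elim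
      | out _ _ _ => cases hg; exact (hl ⟨_, rfl⟩).elim
      | inCtx h _ _ =>
        cases hg with
        | leaf _ => exact (hl ⟨_, rfl⟩).elim
        | node hg' =>
          refine ⟨_, ?_, hg' _ h⟩
          simp [rcvWord, ITree.extract, h, extract_nil]
      | outAcc _ _ hr =>
        exact ⟨t, by simp [rcvWord, extract_nil], hg.trans hr⟩

/-- termination condition. On each infinite path of
`simtree(M₁,M₂)` there are indices `i < j < k` with the same `M₁`-state,
leaf-state inclusions, and condition (i) or (ii) on the extracted contexts. -/
theorem simtree_termination
    {A P Q : Type} [Fintype A] [Fintype P] [Fintype Q]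
    (M1 : Machine A P) (M2 : Machine A Q)
    (c : ℕ → P × ITree A Q) (ℓ : ℕ → Act A)
    (h0 : c 0 = initConfig M1 M2)
    (hstep : ∀ i, Step M1 M2 (c i) (ℓ i) (c (i + 1))) :
    ∃ i j k, i < j ∧ j < k ∧
      (c i).1 = (c j).1 ∧ (c j).1 = (c k).1 ∧
      ((c j).2).leaves ⊆ ((c i).2).leaves ∧
      ((c k).2).leaves ⊆ ((c i).2).leaves ∧
      ∃ ψ, ψ = (List.range (j - i)).map (fun m => ℓ (i + m)) ∧
        ((∃ ω₁ ω₂, rcvWord ψ = ω₁ ++ ω₂ ∧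
            (∃ q, ((c i).2).extract ω₁ = some (ITree.leaf q)) ∧
            (∃ q, ((c k).2).extract ω₁ = some (ITree.leaf q))) ∨
         (∃ ti tk, ((c i).2).extract (rcvWord ψ) = some ti ∧
            ((c k).2).extract (rcvWord ψ) = some tk ∧
            ti.minHeight ≤ tk.minHeight)) := by
  classical
  haveI : Finite (Act A) := Act.finite_act
  let s : ℕ → P × Set Q := fun i => ((c i).1, (c i).2.leaves)
  obtain ⟨K, hK⟩ : ∃ K, K = Nat.card (P × Set Q) + 1 := ⟨_, rfl⟩
  have hpig : ∀ n, ∃ a b : Fin K, a < b ∧ s (n * K + a) = s (n * K + b) := by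
    intro n
    have : ¬ Function.Injective (fun a : Fin K => s (n * K + a)) := by
      intro hinj
      have := Nat.card_le_card_of_injective _ hinj
      simp only [Nat.card_fin] at this
      omega
    simp only [Function.Injective, not_forall] at this
    obtain ⟨a, b, hab, hne⟩ := this
    rcases lt_or_gt_of_ne hne with h | h
    · exact ⟨a, b, h, hab⟩
    · exact ⟨b, a, h, hab.symm⟩
  choose a b hab hs using hpig
  let w : ℕ → List A := fun n =>
    rcvWord ((List.range (b n - a n : ℕ)).map (fun m => ℓ (n * K + a n + m)))
  have hwlen : ∀ n, (w n).length < K := by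
    intro n
    have h1 : (w n).length ≤ (b n - a n : ℕ) := by
      refine (List.length_filterMap_le _ _).trans ?_
      simp
    have := (b n).2
    omega
  let L : ℕ → Set (Fin K) := fun n =>
    {m | ∃ q, ((c (n * K + a n)).2).extract ((w n).take m) = some (ITree.leaf q)}
  let col : ℕ → Fin K × Fin K × (P × Set Q) × (Fin K → Act A) × Set (Fin K) := fun n =>
    (a n, b n, s (n * K + a n), (fun t => ℓ (n * K + t)), L n)
  obtain ⟨y, hy⟩ := Finite.exists_infinite_fiber col
  have hinf : (col ⁻¹' {y}).Infinite := Set.infinite_coe_iff.mp hy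
  let g : ℕ → ℕ := fun n =>
    ((((c (n * K + a n)).2).extract (w n)).map ITree.minHeight).getD 0
  obtain ⟨n, hn, hmin⟩ : ∃ n ∈ col ⁻¹' {y}, ∀ n' ∈ col ⁻¹' {y}, g n ≤ g n' := by
    have hne := hinf.nonempty
    refine ⟨Function.argminOn g _ hne, Function.argminOn_mem _ _ _, fun n' h' =>
      Function.argminOn_le _ _ h'⟩
  obtain ⟨n', hn', hlt⟩ := hinf.exists_gt n
  have hg := hmin n' hn'
  have hcol : col n = col n' := by
    rw [Set.mem_preimage, Set.mem_singleton_iff] at hn hn'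
    rw [hn, hn']
  simp only [col, Prod.mk.injEq] at hcol
  obtain ⟨ha, hb, hss, hl, hL⟩ := hcol
  have hww : w n = w n' := by
    simp only [w]
    rw [ha, hb]
    congr 1
    apply List.map_congr_left
    intro m hm
    rw [List.mem_range] at hm
    have hbb := (b n').2
    have := congrFun hl ⟨a n' + m, by omega⟩
    simpa [add_assoc] using this
  have hmul : n * K + K ≤ n' * K := by
    have := Nat.mul_le_mul_right K (Nat.succ_le_of_lt hlt)
    rwa [Nat.succ_mul] at this
  have hbn := (b n).2
  have habn : (a n : ℕ) < b n := hab n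
  have hsn := hs n
  simp only [s, Prod.mk.injEq] at hsn hss
  refine ⟨n * K + a n, n * K + b n, n' * K + a n', by omega, by omega, hsn.1,
    hsn.1.symm.trans hss.1, hsn.2.ge, hss.2.ge, _, rfl, ?_⟩
  have hsub : n * K + (b n : ℕ) - (n * K + a n) = b n - a n := by omega
  rw [hsub]
  change (∃ ω₁ ω₂, w n = ω₁ ++ ω₂ ∧ _ ∧ _) ∨ (∃ ti tk, ITree.extract _ (w n) = _ ∧
    ITree.extract _ (w n) = _ ∧ _)
  have key : ∀ n, (∃ m, m ∈ L n) ∨ ∃ t, ((c (n * K + a n)).2).extract (w n) = some t := by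
    intro n
    rcases path_lemma M1 M2 c ℓ hstep (n * K + a n) (b n - a n) with ⟨ω₁, hp, hq⟩ | ⟨t, ht, _⟩
    · left
      refine ⟨⟨ω₁.length, lt_of_le_of_lt hp.length_le (hwlen n)⟩, ?_⟩
      have h2 := List.prefix_iff_eq_take.mp hp
      obtain ⟨q, hq⟩ := hq
      refine ⟨q, ?_⟩
      simp only [w]
      rw [← h2]
      exact hq
    · exact Or.inr ⟨t, ht⟩
  by_cases hm : ∃ m, m ∈ L n
  · left
    obtain ⟨m, hm⟩ := hm
    have hm' : m ∈ L n' := hL ▸ hm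
    refine ⟨(w n).take m, (w n).drop m, (List.take_append_drop _ _).symm, hm, ?_⟩
    rw [hww]
    exact hm'
  · right
    obtain ⟨ti, hti⟩ := (key n).resolve_left hm
    obtain ⟨tk, htk⟩ := (key n').resolve_left (hL ▸ hm)
    refine ⟨ti, tk, hti, hww ▸ htk, ?_⟩
    simpa [g, hti, htk] using hg

end AsyncSession
end

section
/- Let M = (Q,q₀,δ) be a communicating machine, Q' ⊆ Q a finite set of states, ψ ∈ Act* and k ∈ ℕ. If minAcc(k,Q',ψ) is defined, then for each k' ≥ k the value minAcc(k',Q',ψ) is defined and k − minAcc(k,Q',ψ) = k' − minAcc(k',Q',ψ). -/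
namespace AsyncSession

variable {A P Q S V W' : Type}

/-- Proposition, item 1. If `minAcc(k,Q',ψ)` is defined then for
each `k' ≥ k` the value `minAcc(k',Q',ψ)` is defined and
`k − minAcc(k,Q',ψ) = k' − minAcc(k',Q',ψ)`. -/
theorem minAcc_shift
    {A S : Type} [Fintype A] [Fintype S]
    (M : Machine A S) (Qs : Set S) (ψ : List (Act A)) (k k' r : ℕ)
    (h : MinAcc M ψ k Qs r) (hk : k ≤ k') :
    ∃ r', MinAcc M ψ k' Qs r' ∧ (k : ℤ) - (r : ℤ) = (k' : ℤ) - (r' : ℤ) := by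
  obtain ⟨d, rfl⟩ := Nat.exists_eq_add_of_le hk
  refine ⟨r + d, ?_, by push_cast; ring⟩
  clear hk
  induction ψ generalizing k Qs with
  | nil =>
    simp only [MinAcc] at h ⊢
    omega
  | cons l ψ ih =>
    cases l with
    | recv a =>
      simp only [MinAcc] at h ⊢
      obtain ⟨h0, h1⟩ := h
      refine ⟨by omega, ?_⟩
      have h2 := ih _ _ h1
      have e : k + d - 1 = k - 1 + d := by omega
      rw [e]
      exact h2
    | send a =>
      simp only [MinAcc] at h ⊢
      obtain ⟨hn, T, hT, h1⟩ := h
      refine ⟨hn, T, hT, ?_⟩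
      have h2 := ih _ _ h1
      rw [Nat.add_right_comm]
      exact h2


end AsyncSession
end

section
/- Let M = (Q,q₀,δ) be a communicating machine, Q' ⊆ Q a finite set of states, k ∈ ℕ, and ψ = ψ'·ψ'' ∈ Act*. If minAcc(k,Q',ψ'·ψ'') is defined, then minAcc(k,Q',ψ'·ψ'') = minAcc(minAcc(k,Q',ψ'), Q'', ψ''), where Q'' = ⋃_{q∈Q'} {q_h | h∈H such that accTree(q, snd(ψ')) = 𝒜''[q_h]^{h∈H}} is the set of leaf states of the trees accTree(q, snd(ψ')) for q ∈ Q' (here snd(ψ') is the word of messages occurring in send actions of ψ', in order). -/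
namespace AsyncSession

variable {A P Q S V W' : Type}

theorem InTree.uniq {A S : Type} {M : Machine A S} {q : S} {T U : ITree A S}
    (h : InTree M q T) (h' : InTree M q U) : T = U := by
  induction h generalizing U with
  | leaf he =>
    cases h' with
    | leaf _ => rfl
    | node hd hf =>
      rename_i dom hne f
      rw [he] at hd
      exact absurd (Finset.coe_eq_empty.mp hd) hne.ne_empty
  | node hd hf ih =>
    rename_i q dom hne f
    cases h' with
    | leaf he =>
      rw [he] at hd
      exact absurd (Finset.coe_eq_empty.mp hd) hne.ne_empty
    | node hd' hf' =>
      rename_i dom' hne' f'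
      have hdd : dom = dom' := Finset.coe_injective (hd.trans hd'.symm)
      subst hdd
      congr 1
      funext a ha
      have hm : a ∈ M.inSet q := by rw [← hd]; exact ha
      obtain ⟨q', hq'⟩ := hm
      exact ih a ha q' hq' (hf' a ha q' hq')

def bindTree {A S : Type} (g : S → ITree A S) : ITree A S → ITree A S
  | .leaf q => g q
  | .node dom hne f => .node dom hne fun a h => bindTree g (f a h)

theorem mem_leaves_bind {A S : Type} (g : S → ITree A S) (T : ITree A S) (p s : S)
    (hp : p ∈ T.leaves) (hs : s ∈ (g p).leaves) : s ∈ (bindTree g T).leaves := by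
  induction T with
  | leaf q =>
    simp only [ITree.leaves, Set.mem_singleton_iff] at hp
    subst hp; exact hs
  | node dom hne f ih =>
    obtain ⟨a, ha, h⟩ := hp
    exact ⟨a, ha, ih a ha h⟩

theorem replace_bind {A S : Type} (R : S → S → Prop) (R' : S → ITree A S → Prop)
    (g : S → ITree A S) {T U : ITree A S}
    (h : ReplaceLeaves (fun p t => ∃ p', R p p' ∧ t = .leaf p') T U)
    (hg : ∀ p ∈ U.leaves, R' p (g p)) :
    ReplaceLeaves (fun p t => ∃ p', R p p' ∧ R' p' t) T (bindTree g U) := by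
  induction h with
  | leaf h =>
    obtain ⟨p', hp, rfl⟩ := h
    exact .leaf ⟨p', hp, hg p' rfl⟩
  | node _ ih =>
    exact .node fun a ha => ih a ha fun p hp => hg p ⟨a, ha, hp⟩

theorem replace_leaf_inv {A S : Type} {R : S → ITree A S → Prop} {T U : ITree A S}
    (h : ReplaceLeaves R T U) (s : S) (hs : s ∈ U.leaves) :
    ∃ p ∈ T.leaves, ∃ t, R p t ∧ s ∈ t.leaves := by
  induction h with
  | leaf h => exact ⟨_, rfl, _, h, hs⟩
  | node _ ih =>
    obtain ⟨a, ha, h⟩ := hs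
    obtain ⟨p, hp, t, h1, h2⟩ := ih a ha h
    exact ⟨p, ⟨a, ha, hp⟩, t, h1, h2⟩

theorem replace_leaf_fwd {A S : Type} {R : S → ITree A S → Prop} {T U : ITree A S}
    (h : ReplaceLeaves R T U) (p : S) (hp : p ∈ T.leaves) :
    ∃ t, R p t ∧ ∀ s ∈ t.leaves, s ∈ U.leaves := by
  induction h with
  | leaf h =>
    simp only [ITree.leaves, Set.mem_singleton_iff] at hp
    subst hp
    exact ⟨_, h, fun _ h => h⟩
  | node _ ih =>
    obtain ⟨a, ha, h⟩ := hp
    obtain ⟨t, h1, h2⟩ := ih a ha h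
    exact ⟨t, h1, fun s hs => ⟨a, ha, h2 s hs⟩⟩

theorem accTree_bind {A S : Type} {M : Machine A S} {a : A} {ω : List A} {q : S}
    {U : ITree A S} (g : S → ITree A S) (h : AccTree M [a] q U)
    (hg : ∀ p ∈ U.leaves, AccTree M ω p (g p)) : AccTree M (a :: ω) q (bindTree g U) := by
  obtain ⟨T, hT, hR⟩ := h
  exact ⟨T, hT, replace_bind (fun p p' => M.trans p (.send a) p') (AccTree M ω) g hR hg⟩

theorem minAcc_accTree {A S : Type} (M : Machine A S) (ψ : List (Act A)) :
    ∀ (k : ℕ) (Qs : Set S) (r : ℕ), MinAcc M ψ k Qs r →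
      ∀ q ∈ Qs, ∃ t, AccTree M (sndWord ψ) q t := by
  induction ψ with
  | nil => intro k Qs r _ q _; exact ⟨_, rfl⟩
  | cons ℓ ψ ih =>
    intro k Qs r h q hq
    cases ℓ with
    | recv a => exact ih _ _ _ h.2 q hq
    | send a =>
      obtain ⟨_, T, hT, h⟩ := h
      have hx := ih _ _ _ h
      classical
      have : Nonempty (ITree A S) := ⟨.leaf q⟩
      choose! g hg using hx
      exact ⟨_, accTree_bind g (hT q hq) fun p hp => hg p ⟨q, hq, hp⟩⟩

theorem accTree_step {A S : Type} {M : Machine A S} {a : A} {ω : List A} {q : S}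
    {U : ITree A S} (h : AccTree M [a] q U)
    (hd : ∀ p ∈ U.leaves, ∃ t, AccTree M ω p t) (s : S) :
    (∃ t, AccTree M (a :: ω) q t ∧ s ∈ t.leaves) ↔
      ∃ p ∈ U.leaves, ∃ t, AccTree M ω p t ∧ s ∈ t.leaves := by
  constructor
  · rintro ⟨t, ⟨T, hT, hR⟩, hs⟩
    obtain ⟨T', hT', hR'⟩ := h
    obtain rfl := hT.uniq hT'
    obtain ⟨p, hp, t', ⟨p', htr, hacc⟩, hs'⟩ := replace_leaf_inv hR s hs
    obtain ⟨t1, ⟨p1, htr1, h1⟩, h2⟩ := replace_leaf_fwd hR' p hp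
    obtain rfl := M.deterministic _ _ _ _ htr htr1
    have h1' : t1 = .leaf p' := h1
    subst h1'
    exact ⟨p', h2 p' rfl, t', hacc, hs'⟩
  · rintro ⟨p, hp, t, ht, hs⟩
    classical
    have : Nonempty (ITree A S) := ⟨.leaf q⟩
    choose! g hg using hd
    refine ⟨bindTree (Function.update g p t) U, accTree_bind _ h ?_, ?_⟩
    · intro p' hp'
      by_cases e : p' = p
      · subst e; simpa using ht
      · simpa [e] using hg p' hp'
    · exact mem_leaves_bind _ _ p s hp (by simpa using hs)

/-- Proposition, item 2. `minAcc` decomposes along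
concatenation: `minAcc(k,Q',ψ'·ψ'') = minAcc(minAcc(k,Q',ψ'),Q'',ψ'')` where
`Q''` is the set of leaf states of the trees `accTree(q,snd(ψ'))` for `q ∈ Q'`. -/
theorem minAcc_append
    {A S : Type} [Fintype A] [Fintype S]
    (M : Machine A S) (Qs : Set S) (ψ' ψ'' : List (Act A)) (k r : ℕ)
    (h : MinAcc M (ψ' ++ ψ'') k Qs r) :
    ∃ m, MinAcc M ψ' k Qs m ∧
      MinAcc M ψ'' m
        {q' | ∃ q ∈ Qs, ∃ t, AccTree M (sndWord ψ') q t ∧ q' ∈ t.leaves} r := by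
  induction ψ' generalizing k Qs with
  | nil =>
    refine ⟨k, rfl, ?_⟩
    have e : {q' | ∃ q ∈ Qs, ∃ t, AccTree M (sndWord ([] : List (Act A))) q t ∧ q' ∈ t.leaves}
        = Qs := by
      ext s
      constructor
      · rintro ⟨q, hq, t, ht, hs⟩
        have ht' : t = .leaf q := ht
        subst ht'
        have hs' : s = q := hs
        subst hs'
        exact hq
      · intro hs
        exact ⟨s, hs, _, rfl, rfl⟩
    rw [e]
    exact h
  | cons ℓ ψ ih =>
    cases ℓ with
    | recv a =>
      obtain ⟨hk, h⟩ := h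
      obtain ⟨m, h1, h2⟩ := ih _ _ h
      exact ⟨m, ⟨hk, h1⟩, h2⟩
    | send a =>
      obtain ⟨hne, T, hT, h⟩ := h
      obtain ⟨m, h1, h2⟩ := ih _ _ h
      refine ⟨m, ⟨hne, T, hT, h1⟩, ?_⟩
      have hd := minAcc_accTree M ψ _ _ _ h1
      convert h2 using 1
      ext s
      have key := fun q (hq : q ∈ Qs) =>
        accTree_step (hT q hq) (fun p hp => hd p ⟨q, hq, hp⟩) s
      constructor
      · rintro ⟨q, hq, ht⟩
        obtain ⟨p, hp, ht⟩ := (key q hq).1 ht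
        exact ⟨p, ⟨q, hq, hp⟩, ht⟩
      · rintro ⟨p, ⟨q, hq, hp⟩, ht⟩
        exact ⟨q, hq, (key q hq).2 ⟨p, hp, ht⟩⟩

end AsyncSession
end
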